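/- arXiv:1708.01270 — 2 statements merged into one kernel-verified Lean document; each statement's English description precedes it below -/
import Mathlib

section
/- Let τ₁, τ₂ ∈ ℂ with Im τ₁ > 0 and Im τ₂ > 0, and define for v = (v₁, v₂) ∈ ℂ² the function θ_A(v₁, v₂) = ∑_{(l₁,l₂) ∈ ℤ²} [ exp(πi l₁² τ₁ + πi (l₂ + 3/4)² τ₂ + 2πi l₁ v₁ + 2πi (l₂ + 3/4) v₂) − exp(πi l₁² τ₁ + πi (l₂ + 1/4)² τ₂ + 2πi l₁ v₁ + 2πi (l₂ + 1/4) v₂) ]. Then θ_A(v₁, v₂) = 0 whenever v₁ = 1/2 + τ₁/2 (for every v₂ ∈ ℂ), and θ_A(v₁, v₂) = 0 whenever v₂ ∈ {0, 2, τ₂/2, 2 + τ₂/2} (for every v₁ ∈ ℂ). -/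
/-- The odd theta function `θ_A = Θ_{3ω} - Θ_ω` for the diagonal period matrix
`diag(τ₁, τ₂)`, written out as a double series over `ℤ²`. -/
noncomputable def thetaAProd (τ₁ τ₂ v₁ v₂ : ℂ) : ℂ :=
  ∑' p : ℤ × ℤ,
    (Complex.exp ((Real.pi : ℂ) * Complex.I * (p.1 : ℂ) ^ 2 * τ₁ +
        (Real.pi : ℂ) * Complex.I * ((p.2 : ℂ) + 3 / 4) ^ 2 * τ₂ +
        2 * (Real.pi : ℂ) * Complex.I * (p.1 : ℂ) * v₁ +
        2 * (Real.pi : ℂ) * Complex.I * ((p.2 : ℂ) + 3 / 4) * v₂) -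
      Complex.exp ((Real.pi : ℂ) * Complex.I * (p.1 : ℂ) ^ 2 * τ₁ +
        (Real.pi : ℂ) * Complex.I * ((p.2 : ℂ) + 1 / 4) ^ 2 * τ₂ +
        2 * (Real.pi : ℂ) * Complex.I * (p.1 : ℂ) * v₁ +
        2 * (Real.pi : ℂ) * Complex.I * ((p.2 : ℂ) + 1 / 4) * v₂))

/-- A series whose terms change sign under a permutation of the index set has sum zero. -/
theorem tsum_eq_zero_of_comp_equiv_eq_neg {ι : Type*} (e : ι ≃ ι) {f : ι → ℂ}
    (hf : ∀ i, f (e i) = -f i) : ∑' i, f i = 0 := by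
  have h : ∑' i, f i = -∑' i, f i := by
    rw [← tsum_neg, ← e.tsum_eq f]
    exact tsum_congr hf
  exact self_eq_neg.mp h

theorem Complex.exp_eq_neg_exp_of_eq_add {x y : ℂ} (n : ℤ)
    (h : x = y + Real.pi * Complex.I + n * (2 * Real.pi * Complex.I)) :
    Complex.exp x = -Complex.exp y := by
  rw [← Complex.exp_add_pi_mul_I, Complex.exp_eq_exp_iff_exists_int]
  exact ⟨n, h⟩

theorem thetaAProd_half_add_half_left (τ₁ τ₂ v₂ : ℂ) :
    thetaAProd τ₁ τ₂ (1 / 2 + τ₁ / 2) v₂ = 0 := by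
  refine tsum_eq_zero_of_comp_equiv_eq_neg
    ((Equiv.subLeft (-1 : ℤ)).prodCongr (Equiv.refl ℤ)) fun ⟨l, m⟩ => ?_
  simp only [Equiv.prodCongr_apply, Prod.map_apply, Equiv.subLeft_apply, Equiv.refl_apply]
  rw [neg_sub']
  congr 1
  · refine Complex.exp_eq_neg_exp_of_eq_add (-1 - l) ?_
    push_cast
    ring
  · refine Complex.exp_eq_neg_exp_of_eq_add (-1 - l) ?_
    push_cast
    ring

/-- `θ_A` vanishes on the lines `v₂ = 2s + tτ₂/2` with `s` and `t` integers. -/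
theorem thetaAProd_two_mul_add_mul_half_right (τ₁ τ₂ v₁ : ℂ) (s t : ℤ) :
    thetaAProd τ₁ τ₂ v₁ (2 * s + t * (τ₂ / 2)) = 0 := by
  refine tsum_eq_zero_of_comp_equiv_eq_neg
    ((Equiv.refl ℤ).prodCongr (Equiv.subLeft (-1 - t))) fun ⟨l, m⟩ => ?_
  simp only [Equiv.prodCongr_apply, Prod.map_apply, Equiv.subLeft_apply, Equiv.refl_apply]
  rw [neg_sub]
  congr 1
  · rw [Complex.exp_eq_exp_iff_exists_int]
    refine ⟨s * (-4 * m - 1 - 2 * t), ?_⟩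
    push_cast
    ring
  · rw [Complex.exp_eq_exp_iff_exists_int]
    refine ⟨s * (-4 * m - 3 - 2 * t), ?_⟩
    push_cast
    ring

/-- The zero locus of `θ_A` in the product case contains the line
`v₁ = 1/2 + τ₁/2` and the four lines `v₂ = 0, 2, τ₂/2, 2 + τ₂/2`. -/
theorem stmt_2 (τ₁ τ₂ : ℂ) (h₁ : 0 < τ₁.im) (h₂ : 0 < τ₂.im) :
    (∀ v₂ : ℂ, thetaAProd τ₁ τ₂ (1 / 2 + τ₁ / 2) v₂ = 0) ∧
    (∀ v₁ : ℂ, ∀ v₂ ∈ ({0, 2, τ₂ / 2, 2 + τ₂ / 2} : Set ℂ),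
      thetaAProd τ₁ τ₂ v₁ v₂ = 0) := by
  refine ⟨thetaAProd_half_add_half_left τ₁ τ₂, fun v₁ v₂ hv => ?_⟩
  rcases hv with rfl | rfl | rfl | rfl
  · simpa using thetaAProd_two_mul_add_mul_half_right τ₁ τ₂ v₁ 0 0
  · simpa using thetaAProd_two_mul_add_mul_half_right τ₁ τ₂ v₁ 1 0
  · simpa using thetaAProd_two_mul_add_mul_half_right τ₁ τ₂ v₁ 0 1
  · simpa using thetaAProd_two_mul_add_mul_half_right τ₁ τ₂ v₁ 1 1
end

section
/- Let τ₂ ∈ ℂ with Im τ₂ > 0 and let v₂ ∈ {τ₂/2, 2 + τ₂/2}. Define b_l^± = exp(πi (l + 1/2 ± 1/4)² τ₂ + 2πi v₂ (l + 1/2 ± 1/4)) for l ∈ ℤ. Then b_l^+ = b_{−l−2}^− for every l ∈ ℤ, and consequently ∑_{l ∈ ℤ} b_l^+ = ∑_{l ∈ ℤ} b_l^− (both series converging absolutely). -/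
/-- `b_l⁺ = exp(πi (l + 1/2 + 1/4)² τ₂ + 2πi v₂ (l + 1/2 + 1/4))`. -/
noncomputable def bPlus (τ₂ v₂ : ℂ) (l : ℤ) : ℂ :=
  Complex.exp ((Real.pi : ℂ) * Complex.I * ((l : ℂ) + 1 / 2 + 1 / 4) ^ 2 * τ₂ +
    2 * (Real.pi : ℂ) * Complex.I * v₂ * ((l : ℂ) + 1 / 2 + 1 / 4))

/-- `b_l⁻ = exp(πi (l + 1/2 - 1/4)² τ₂ + 2πi v₂ (l + 1/2 - 1/4))`. -/
noncomputable def bMinus (τ₂ v₂ : ℂ) (l : ℤ) : ℂ :=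
  Complex.exp ((Real.pi : ℂ) * Complex.I * ((l : ℂ) + 1 / 2 - 1 / 4) ^ 2 * τ₂ +
    2 * (Real.pi : ℂ) * Complex.I * v₂ * ((l : ℂ) + 1 / 2 - 1 / 4))

/-- The series of a theta function with complex shift `a` converges absolutely. -/
theorem summable_shifted_theta_term (a v τ : ℂ) (hτ : 0 < τ.im) :
    Summable fun l : ℤ ↦ Complex.exp ((Real.pi : ℂ) * Complex.I * ((l : ℂ) + a) ^ 2 * τ +
      2 * (Real.pi : ℂ) * Complex.I * v * ((l : ℂ) + a)) := by
  refine (((summable_jacobiTheta₂_term_iff (v + a * τ) τ).mpr hτ).mul_left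
    (Complex.exp ((Real.pi : ℂ) * Complex.I * a ^ 2 * τ +
      2 * (Real.pi : ℂ) * Complex.I * v * a))).congr fun l ↦ ?_
  rw [jacobiTheta₂_term, ← Complex.exp_add]
  congr 1
  ring

theorem bPlus_eq_bMinus (τ₂ v₂ : ℂ) (hv : v₂ ∈ ({τ₂ / 2, 2 + τ₂ / 2} : Set ℂ)) (l : ℤ) :
    bPlus τ₂ v₂ l = bMinus τ₂ v₂ (-l - 2) := by
  unfold bPlus bMinus
  rcases hv with rfl | rfl
  · congr 1
    push_cast
    ring
  · refine Complex.exp_eq_exp_iff_exists_int.mpr ⟨4 * l + 5, ?_⟩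
    push_cast
    ring

/-- For `v₂ ∈ {τ₂ / 2, 2 + τ₂ / 2}` one has `b_l⁺ = b_{-l-2}⁻`, both series converge
absolutely, and `∑ b_l⁺ = ∑ b_l⁻`. -/
theorem stmt_10 (τ₂ : ℂ) (h₂ : 0 < τ₂.im) (v₂ : ℂ) (hv : v₂ ∈ ({τ₂ / 2, 2 + τ₂ / 2} : Set ℂ)) :
    (∀ l : ℤ, bPlus τ₂ v₂ l = bMinus τ₂ v₂ (-l - 2)) ∧
    Summable (bPlus τ₂ v₂) ∧ Summable (bMinus τ₂ v₂) ∧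
    (∑' l : ℤ, bPlus τ₂ v₂ l) = ∑' l : ℤ, bMinus τ₂ v₂ l := by
  refine ⟨bPlus_eq_bMinus τ₂ v₂ hv, ?_, ?_, ?_⟩
  · refine (summable_shifted_theta_term (1 / 2 + 1 / 4) v₂ τ₂ h₂).congr fun l ↦ ?_
    simp only [bPlus, add_assoc]
  · refine (summable_shifted_theta_term (1 / 2 - 1 / 4) v₂ τ₂ h₂).congr fun l ↦ ?_
    simp only [bMinus, add_sub_assoc]
  · rw [← ((Equiv.neg ℤ).trans (Equiv.subRight 2)).tsum_eq (bMinus τ₂ v₂)]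
    exact tsum_congr (bPlus_eq_bMinus τ₂ v₂ hv)
end
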